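/- Theorem 3.2 (Local Stability ⟹ Convergence): Given a well posed nonlinear semigroup E on a real normed vector space X and a numerical method C that is locally stable and consistent with E, the numerical method is convergent to the nonlinear semigroup. -/

import Mathlib

open Set

variable (X : Type*) [NormedAddCommGroup X] [NormedSpace ℝ X]

/-- The set `Z = ⋃_{t ≥ 0} {t} × X_t ⊆ [0,∞) × X`. -/
def ZSet (Xt : ℝ → Set X) : Set (ℝ × X) :=
  {p : ℝ × X | 0 ≤ p.1 ∧ p.2 ∈ Xt p.1}

/-- A nonlinear semigroup on `X`: a family of subsets `Xt t ⊆ X` with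
`X_{t+s} ⊆ X_t`, together with maps `E t : X → X` with `E 0 = id` on `X_0`,
`E t` mapping `X_{t+s}` into `X_s`, and the semigroup law. -/
structure IsNonlinearSemigroup (Xt : ℝ → Set X) (E : ℝ → X → X) : Prop where
  nested : ∀ t s : ℝ, 0 ≤ t → 0 ≤ s → Xt (t + s) ⊆ Xt t
  id_zero : ∀ u ∈ Xt 0, E 0 u = u
  maps : ∀ t s : ℝ, 0 ≤ t → 0 ≤ s → ∀ u ∈ Xt (t + s), E t u ∈ Xt s
  comp : ∀ t s : ℝ, 0 ≤ t → 0 ≤ s → ∀ u ∈ Xt (t + s), E (t + s) u = E s (E t u)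

/-- Well posedness: `(t,u) ↦ E t u` is continuous on `Z`. -/
def WellPosed (Xt : ℝ → Set X) (E : ℝ → X → X) : Prop :=
  ContinuousOn (fun p : ℝ × X => E p.1 p.2) (ZSet X Xt)

/-- A numerical method: a continuous map `C : [0,∞) × X → X` with `C 0 = id`. -/
structure IsNumericalMethod (C : ℝ → X → X) : Prop where
  cont : ContinuousOn (fun p : ℝ × X => C p.1 p.2) {p : ℝ × X | 0 ≤ p.1}
  id_zero : ∀ u : X, C 0 u = u

/-- A regular subset `Z' ⊆ Z`: closed, and invariant (in the appropriate sense)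
under the semigroup and the numerical method.  Here `X'_t = {u | (t,u) ∈ Z'}`. -/
def RegularSet (Xt : ℝ → Set X) (E C : ℝ → X → X) (Z' : Set (ℝ × X)) : Prop :=
  Z' ⊆ ZSet X Xt ∧ IsClosed Z' ∧
  (∀ t s : ℝ, 0 ≤ t → 0 ≤ s → ∀ u : X, (t + s, u) ∈ Z' → (s, E t u) ∈ Z') ∧
  (∀ t Δt : ℝ, 0 ≤ t → 0 ≤ Δt → ∀ u : X, (t + Δt, u) ∈ Z' → (t, C Δt u) ∈ Z')

/-- Local stability (Definition 2.3). -/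
def LocallyStable (Xt : ℝ → Set X) (E C : ℝ → X → X) : Prop :=
  ∀ Z' : Set (ℝ × X), RegularSet X Xt E C Z' →
  ∀ T : ℝ, 0 < T → ∀ K : Set X, IsCompact K →
  ∃ L' ρ' : ℝ, 0 < L' ∧ 0 < ρ' ∧
    ∀ (Δt : ℝ) (n : ℕ) (u v : X), 0 < Δt → (n : ℝ) * Δt ≤ T →
      u ∈ K → v ∈ K → ((n : ℝ) * Δt, u) ∈ Z' → ((n : ℝ) * Δt, v) ∈ Z' →
      ‖v - u‖ ≤ ρ' → ‖(C Δt)^[n] v - (C Δt)^[n] u‖ ≤ L' * ‖v - u‖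

/-- Distant stability (Definition 2.4). -/
def DistantlyStable (Xt : ℝ → Set X) (E C : ℝ → X → X) : Prop :=
  ∀ Z' : Set (ℝ × X), RegularSet X Xt E C Z' →
  ∀ T : ℝ, 0 < T → ∀ K : Set X, IsCompact K → ∀ ρ : ℝ, 0 < ρ →
  ∃ L'' : ℝ, 0 < L'' ∧
    ∀ (Δt : ℝ) (n : ℕ) (u v : X), 0 < Δt → (n : ℝ) * Δt ≤ T →
      u ∈ K → v ∈ K → ((n : ℝ) * Δt, u) ∈ Z' → ((n : ℝ) * Δt, v) ∈ Z' →
      ρ ≤ ‖v - u‖ → ‖(C Δt)^[n] v - (C Δt)^[n] u‖ ≤ L'' * ‖v - u‖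

/-- Stability (Definition 2.5). -/
def Stable (Xt : ℝ → Set X) (E C : ℝ → X → X) : Prop :=
  ∀ Z' : Set (ℝ × X), RegularSet X Xt E C Z' →
  ∀ T : ℝ, 0 < T → ∀ K : Set X, IsCompact K →
  ∃ L : ℝ, 0 < L ∧
    ∀ (Δt : ℝ) (n : ℕ) (u v : X), 0 < Δt → (n : ℝ) * Δt ≤ T →
      u ∈ K → v ∈ K → ((n : ℝ) * Δt, u) ∈ Z' → ((n : ℝ) * Δt, v) ∈ Z' →
      ‖(C Δt)^[n] v - (C Δt)^[n] u‖ ≤ L * ‖v - u‖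

/-- Convergence of the numerical method to the semigroup (Definition 3.1). -/
def Convergent (Xt : ℝ → Set X) (E C : ℝ → X → X) : Prop :=
  ∀ Z' : Set (ℝ × X), RegularSet X Xt E C Z' →
  ∀ T : ℝ, 0 < T → ∀ K : Set X, IsCompact K → ∀ ε : ℝ, 0 < ε →
  ∃ θ : ℝ, 0 < θ ∧
    ∀ (t Δt : ℝ) (n : ℕ) (u : X), t ∈ Icc (0 : ℝ) T → 0 < Δt →
      u ∈ K → (t, u) ∈ Z' → ((n : ℝ) * Δt, u) ∈ Z' →
      Δt ≤ θ → |t - (n : ℝ) * Δt| ≤ θ →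
      ‖E t u - (C Δt)^[n] u‖ ≤ ε

/-- Consistency of the numerical method with the semigroup (Definition 3.2). -/
def Consistent (Xt : ℝ → Set X) (E C : ℝ → X → X) : Prop :=
  ∀ Z' : Set (ℝ × X), RegularSet X Xt E C Z' →
  ∀ T : ℝ, 0 < T → ∀ K : Set X, IsCompact K → ∀ ε : ℝ, 0 < ε →
  ∃ δ : ℝ, 0 < δ ∧
    ∀ (t Δt : ℝ) (u : X), t ∈ Icc (0 : ℝ) T → 0 < Δt → Δt ≤ δ →
      u ∈ K → (t + Δt, u) ∈ Z' →
      ‖C Δt (E t u) - E Δt (E t u)‖ ≤ ε * Δt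

/-- Condition (4.3): the optimal distant-stability constants remain bounded as
`ρ ↓ 0`, i.e. one constant works simultaneously for all `ρ > 0`. -/
def Condition43 (Xt : ℝ → Set X) (E C : ℝ → X → X) : Prop :=
  ∀ Z' : Set (ℝ × X), RegularSet X Xt E C Z' →
  ∀ T : ℝ, 0 < T → ∀ K : Set X, IsCompact K →
  ∃ M : ℝ, 0 < M ∧
    ∀ ρ : ℝ, 0 < ρ →
    ∀ (Δt : ℝ) (n : ℕ) (u v : X), 0 < Δt → (n : ℝ) * Δt ≤ T →
      u ∈ K → v ∈ K → ((n : ℝ) * Δt, u) ∈ Z' → ((n : ℝ) * Δt, v) ∈ Z' →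
      ρ ≤ ‖v - u‖ → ‖(C Δt)^[n] v - (C Δt)^[n] u‖ ≤ M * ‖v - u‖

/-- The truncated downward closure in time of `Z'`: all `(s, u)` with `(t, u) ∈ Z'` for some
`t ∈ [s, S]`. Unlike `Z'`, its time slices are nested. -/
def timeClosure (S : ℝ) (Z' : Set (ℝ × X)) : Set (ℝ × X) :=
  {p | 0 ≤ p.1 ∧ ∃ t, p.1 ≤ t ∧ t ≤ S ∧ (t, p.2) ∈ Z'}

theorem isClosed_timeClosure {X : Type*} [NormedAddCommGroup X] (S : ℝ)
    {Z' : Set (ℝ × X)} (hZ : IsClosed Z') :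
    IsClosed (timeClosure X S Z') := by
  let W : Set (Icc (0 : ℝ) S × (ℝ × X)) :=
    {q | 0 ≤ q.2.1 ∧ q.2.1 ≤ q.1 ∧ ((q.1 : ℝ), q.2.2) ∈ Z'}
  have h0 : Continuous fun q : Icc (0 : ℝ) S × (ℝ × X) => q.2.1 := by fun_prop
  have h1 : Continuous fun q : Icc (0 : ℝ) S × (ℝ × X) => (q.1 : ℝ) := by fun_prop
  have h2 : Continuous fun q : Icc (0 : ℝ) S × (ℝ × X) => ((q.1 : ℝ), q.2.2) := by fun_prop
  have hW : IsClosed W :=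
    (isClosed_le continuous_const h0).inter ((isClosed_le h0 h1).inter (hZ.preimage h2))
  have himg : timeClosure X S Z' = Prod.snd '' W := by
    ext ⟨s, u⟩
    constructor
    · rintro ⟨hs, t, hst, htS, ht⟩
      exact ⟨(⟨t, hs.trans hst, htS⟩, (s, u)), ⟨hs, hst, ht⟩, rfl⟩
    · rintro ⟨⟨t, p⟩, ⟨h0, hle, hm⟩, rfl⟩
      exact ⟨h0, t, hle, t.2.2, hm⟩
  rw [himg]
  exact isClosedMap_snd_of_compactSpace W hW

theorem RegularSet.timeClosure {X : Type*} [NormedAddCommGroup X] {Xt : ℝ → Set X}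
    {E C : ℝ → X → X} {Z' : Set (ℝ × X)}
    (hZ : RegularSet X Xt E C Z') (hE : IsNonlinearSemigroup X Xt E) (S : ℝ) :
    RegularSet X Xt E C (timeClosure X S Z') := by
  obtain ⟨hsub, hcl, hEinv, hCinv⟩ := hZ
  refine ⟨?_, isClosed_timeClosure S hcl, ?_, ?_⟩
  · rintro ⟨s, u⟩ ⟨hs, t, hst, -, ht⟩
    refine ⟨hs, hE.nested s (t - s) hs (sub_nonneg.2 hst) ?_⟩
    simpa using (hsub ht).2
  · rintro t s ht hs u ⟨-, r, hr, hrS, hu⟩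
    have hr : t + s ≤ r := hr
    refine ⟨hs, r - t, by simp only; linarith, by linarith,
      hEinv t (r - t) ht (by linarith) u (by simpa using hu)⟩
  · rintro t s ht hs u ⟨-, r, hr, hrS, hu⟩
    have hr : t + s ≤ r := hr
    refine ⟨ht, r - s, by simp only; linarith, by linarith,
      hCinv (r - s) s (by linarith) hs u (by simpa using hu)⟩

theorem mem_timeClosure_of_le {X : Type*} [NormedAddCommGroup X] {S s t : ℝ} {u : X}
    {Z' : Set (ℝ × X)} (h : (t, u) ∈ timeClosure X S Z') (hs : 0 ≤ s) (hst : s ≤ t) :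
    (s, u) ∈ timeClosure X S Z' := by
  obtain ⟨-, r, hr, hrS, hu⟩ := h
  exact ⟨hs, r, hst.trans hr, hrS, hu⟩

/-- Telescoping estimate comparing a sequence with the orbit of its first term. -/
theorem norm_sub_iterate_le_of_step {V : Type*} [SeminormedAddCommGroup V] (f : V → V)
    (a : ℕ → V) (n : ℕ) (c : ℝ)
    (h : ∀ j k, j + (k + 1) = n → ‖f^[j] (a (k + 1)) - f^[j] (f (a k))‖ ≤ c) :
    ‖a n - f^[n] (a 0)‖ ≤ n * c := by
  have key : ∀ k j, j + k = n → ‖f^[j] (a k) - f^[n] (a 0)‖ ≤ k * c := by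
    intro k
    induction k with
    | zero => rintro j rfl; simp
    | succ k ih =>
      intro j hj
      have h1 := ih (j + 1) (by omega)
      rw [Function.iterate_succ_apply] at h1
      calc ‖f^[j] (a (k + 1)) - f^[n] (a 0)‖
          ≤ ‖f^[j] (a (k + 1)) - f^[j] (f (a k))‖ + ‖f^[j] (f (a k)) - f^[n] (a 0)‖ :=
            norm_sub_le_norm_sub_add_norm_sub _ _ _
        _ ≤ c + k * c := add_le_add (h j k hj) h1
        _ = ((k + 1 : ℕ) : ℝ) * c := by push_cast; ring
  simpa using key n 0 (by simp)

/-- Theorem 3.2 (Local Stability ⟹ Convergence). -/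
theorem locallyStable_consistent_implies_convergent
    (Xt : ℝ → Set X) (E C : ℝ → X → X)
    (hE : IsNonlinearSemigroup X Xt E) (hWP : WellPosed X Xt E)
    (hC : IsNumericalMethod X C)
    (hls : LocallyStable X Xt E C) (hcons : Consistent X Xt E C) :
    Convergent X Xt E C := by
  intro Z₀ hZ₀ T hT K hK ε hε
  set S := T + 1
  have hSpos : 0 < S := by linarith
  set Z' := timeClosure X S Z₀
  have hreg : RegularSet X Xt E C Z' := hZ₀.timeClosure hE S
  have ⟨hsub, hcl, hEinv, hCinv⟩ := hreg
  set A := (Icc 0 S ×ˢ K) ∩ Z'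
  have hAc : IsCompact A := (isCompact_Icc.prod hK).inter_right hcl
  have hEc : ContinuousOn (fun p : ℝ × X => E p.1 p.2) A :=
    hWP.mono (inter_subset_right.trans hsub)
  set K₁ := (fun p : ℝ × X => E p.1 p.2) '' A
  have hK₁c : IsCompact K₁ := hAc.image_of_continuousOn hEc
  set K₂ := (fun p : ℝ × X => C p.1 p.2) '' (Icc (0 : ℝ) 1 ×ˢ K₁)
  have hK₂c : IsCompact K₂ := (isCompact_Icc.prod hK₁c).image_of_continuousOn
    (hC.cont.mono fun p hp => hp.1.1)
  have hK₁₂ : K₁ ⊆ K₂ := fun v hv => ⟨(0, v), ⟨by simp, hv⟩, hC.id_zero v⟩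
  obtain ⟨L, ρ, hL, hρ, hstab⟩ := hls Z' hreg S hSpos K₂ hK₂c
  set η := ε / (2 * (L * S)) with hη
  have hηpos : 0 < η := by positivity
  obtain ⟨δ, hδ, hδc⟩ := hcons Z' hreg S hSpos K hK η hηpos
  obtain ⟨κ, hκ, hκc⟩ := Metric.uniformContinuousOn_iff.1
    (hAc.uniformContinuousOn_of_continuous hEc) (ε / 2) (by positivity)
  refine ⟨min (min 1 δ) (min (ρ / η) (κ / 2)), by positivity, ?_⟩
  intro t τ n u ht hτ huK htu hnu hτθ hdist
  simp only [le_min_iff] at hτθ hdist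
  obtain ⟨⟨hτ1, hτδ⟩, hτρ, -⟩ := hτθ
  obtain ⟨⟨hd1, -⟩, -, hdκ⟩ := hdist
  have hnS : n * τ ≤ S := by linarith [(abs_le.1 hd1).1, ht.2]
  have hn0 : 0 ≤ n * τ := by positivity
  have htZ : (t, u) ∈ Z' := ⟨ht.1, t, le_rfl, by linarith [ht.2], htu⟩
  have hnZ : (n * τ, u) ∈ Z' := ⟨hn0, n * τ, le_rfl, hnS, hnu⟩
  have hEnear : ‖E t u - E (n * τ) u‖ ≤ ε / 2 := by
    rw [← dist_eq_norm]
    refine (hκc (t, u) ⟨⟨⟨ht.1, by linarith [ht.2]⟩, huK⟩, htZ⟩ (n * τ, u)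
      ⟨⟨⟨hn0, hnS⟩, huK⟩, hnZ⟩ ?_).le
    rw [dist_prod_same_right, Real.dist_eq]
    linarith
  have hE0 : E 0 u = u :=
    hE.id_zero u (hsub (mem_timeClosure_of_le hnZ le_rfl hn0)).2
  have hiter : ‖E (n * τ) u - (C τ)^[n] u‖ ≤ n * (L * (η * τ)) := by
    have := norm_sub_iterate_le_of_step (C τ) (fun k : ℕ => E (k * τ) u) n (L * (η * τ)) ?_
    · simpa [hE0] using this
    intro j k hjk
    have hn : (n : ℝ) * τ = j * τ + (k * τ + τ) := by
      rw [← hjk]; push_cast; ring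
    have hj0 : 0 ≤ j * τ := by positivity
    have hk0 : 0 ≤ k * τ := by positivity
    have hk1 : ((k + 1 : ℕ) : ℝ) * τ = k * τ + τ := by push_cast; ring
    have hkZ : (k * τ + τ, u) ∈ Z' :=
      mem_timeClosure_of_le hnZ (by positivity) (by linarith)
    have hEk : E (((k + 1 : ℕ) : ℝ) * τ) u = E τ (E (k * τ) u) := by
      rw [hk1]
      exact hE.comp _ _ hk0 hτ.le u (hsub hkZ).2
    have hstep := hδc (k * τ) τ u ⟨hk0, by linarith⟩ hτ hτδ huK hkZ
    have hemem : ∀ s, 0 ≤ s → s ≤ n * τ → E s u ∈ K₁ := fun s hs hsn =>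
      ⟨(s, u), ⟨⟨⟨hs, hsn.trans hnS⟩, huK⟩, mem_timeClosure_of_le hnZ hs hsn⟩, rfl⟩
    have hηρ : η * τ ≤ ρ := by rwa [le_div_iff₀' hηpos] at hτρ
    have hCmem : C τ (E (k * τ) u) ∈ K₂ :=
      ⟨(τ, E (k * τ) u), ⟨⟨hτ.le, hτ1⟩, hemem _ hk0 (by linarith)⟩, rfl⟩
    have hEmem : E (((k + 1 : ℕ) : ℝ) * τ) u ∈ K₂ :=
      hK₁₂ (hemem _ (by positivity) (by linarith))
    have hEkZ : (j * τ, E (((k + 1 : ℕ) : ℝ) * τ) u) ∈ Z' :=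
      hEinv _ _ (by positivity) hj0 u (by rwa [hk1, add_comm, ← hn])
    have hCkZ : (j * τ, C τ (E (k * τ) u)) ∈ Z' :=
      hCinv _ _ hj0 hτ.le _ (hEinv _ _ hk0 (by positivity) u
        (by rwa [show k * τ + (j * τ + τ) = n * τ by rw [hn]; ring]))
    have hle : ‖E (((k + 1 : ℕ) : ℝ) * τ) u - C τ (E (k * τ) u)‖ ≤ η * τ := by
      rw [hEk, norm_sub_rev]
      exact hstep
    calc _ ≤ L * ‖E (((k + 1 : ℕ) : ℝ) * τ) u - C τ (E (k * τ) u)‖ :=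
          hstab τ j _ _ hτ (by linarith) hCmem hEmem hCkZ hEkZ (hle.trans hηρ)
      _ ≤ L * (η * τ) := by gcongr
  have hbound : n * (L * (η * τ)) ≤ ε / 2 := by
    calc n * (L * (η * τ)) = L * η * (n * τ) := by ring
      _ ≤ L * η * S := by gcongr
      _ = ε / 2 := by rw [hη]; field_simp
  calc ‖E t u - (C τ)^[n] u‖
      ≤ ‖E t u - E (n * τ) u‖ + ‖E (n * τ) u - (C τ)^[n] u‖ :=
        norm_sub_le_norm_sub_add_norm_sub _ _ _
    _ ≤ ε := by linarith
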